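/- Pohozaev identity I for gBO ground states: let m ≥ 2 be an integer and let Q : ℝ → ℝ be continuously differentiable such that for some C > 0 one has |Q(x)| ≤ C/(1+x²) and |Q′(x)| ≤ C/(1+|x|)³ for all x, for every x the principal value H Q′(x) exists, the function x ↦ H Q′(x) is continuous with |H Q′(x)| ≤ C/(1+x²), and −Q(x) − H Q′(x) + Q(x)^m/m = 0 for all x ∈ ℝ. Then (2/(m(m+1))) ∫_ℝ Q(x)^{m+1} dx = ∫_ℝ Q(x)² dx. -/

import Mathlib

open MeasureTheory Filter

/-- The principal value Hilbert transform of `f : ℝ → ℝ` at `x` exists and equals `A`. -/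
def HilbertPVR (f : ℝ → ℝ) (x A : ℝ) : Prop :=
  Tendsto (fun ε : ℝ =>
      (1 / Real.pi) * ∫ y in {y : ℝ | ε < |x - y|}, f y / (x - y))
    (nhdsWithin 0 (Set.Ioi 0)) (nhds A)

/-- The Cauchy kernel `1 / (u - iε)`. -/
noncomputable def cauchyKernel (ε u : ℝ) : ℂ := ((u : ℂ) - ε * Complex.I)⁻¹

lemma sub_mul_I_ne_zero {ε : ℝ} (hε : 0 < ε) (u : ℝ) : (u : ℂ) - ε * Complex.I ≠ 0 := by
  intro h
  have := congrArg Complex.im h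
  simp at this
  exact hε.ne' this

lemma continuous_cauchyKernel {ε : ℝ} (hε : 0 < ε) : Continuous (cauchyKernel ε) := by
  unfold cauchyKernel
  exact Continuous.inv₀ (by fun_prop) (sub_mul_I_ne_zero hε)

lemma cauchyKernel_re (ε u : ℝ) : (cauchyKernel ε u).re = u / (u ^ 2 + ε ^ 2) := by
  simp [cauchyKernel, Complex.inv_re, Complex.normSq_apply, sq]

lemma cauchyKernel_im (ε u : ℝ) : (cauchyKernel ε u).im = ε / (u ^ 2 + ε ^ 2) := by
  simp [cauchyKernel, Complex.inv_im, Complex.normSq_apply, sq]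

lemma norm_cauchyKernel_sq {ε : ℝ} (hε : 0 < ε) (u : ℝ) :
    ‖cauchyKernel ε u‖ ^ 2 = (u ^ 2 + ε ^ 2)⁻¹ := by
  rw [← Complex.normSq_eq_norm_sq, Complex.normSq_apply, cauchyKernel_re, cauchyKernel_im]
  have : 0 < u ^ 2 + ε ^ 2 := by positivity
  field_simp

lemma norm_cauchyKernel_le {ε : ℝ} (hε : 0 < ε) (u : ℝ) : ‖cauchyKernel ε u‖ ≤ ε⁻¹ := by
  refine (sq_le_sq₀ (norm_nonneg _) (by positivity)).1 ?_
  rw [norm_cauchyKernel_sq hε, inv_pow]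
  apply inv_anti₀ (by positivity)
  nlinarith [sq_nonneg u]

lemma integrable_inv_sq_add_sq {ε : ℝ} (hε : 0 < ε) :
    Integrable fun u : ℝ => (u ^ 2 + ε ^ 2)⁻¹ := by
  have h := (integrable_inv_one_add_sq.comp_mul_left' (inv_ne_zero hε.ne')).const_mul (ε ^ 2)⁻¹
  refine h.congr (.of_forall fun u => ?_)
  have : 0 < u ^ 2 + ε ^ 2 := by positivity
  simp only
  rw [← mul_inv]
  congr 1
  field_simp
  ring

lemma integral_poissonKernel {ε : ℝ} (hε : 0 < ε) :
    ∫ u : ℝ, ε / (u ^ 2 + ε ^ 2) = Real.pi := by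
  have h := Measure.integral_comp_mul_left (fun u : ℝ => (1 + u ^ 2)⁻¹) ε⁻¹
  rw [integral_univ_inv_one_add_sq, inv_inv, abs_of_pos hε, smul_eq_mul] at h
  have h2 : ∀ u : ℝ, ε / (u ^ 2 + ε ^ 2) = ε⁻¹ * (1 + (ε⁻¹ * u) ^ 2)⁻¹ := fun u => by
    have : 0 < u ^ 2 + ε ^ 2 := by positivity
    have : 0 < ε ^ 2 + u ^ 2 := by positivity
    rw [← mul_inv]
    field_simp
    ring
  simp_rw [h2]
  rw [integral_const_mul, h]
  field_simp

lemma norm_cauchyKernel_mul_le {ε : ℝ} (hε : 0 < ε) (x a b : ℝ) :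
    ‖cauchyKernel ε (x - a) * cauchyKernel ε (x - b)‖ ≤
      ((x - a) ^ 2 + ε ^ 2)⁻¹ + ((x - b) ^ 2 + ε ^ 2)⁻¹ := by
  rw [norm_mul, ← norm_cauchyKernel_sq hε, ← norm_cauchyKernel_sq hε]
  nlinarith [sq_nonneg (‖cauchyKernel ε (x - a)‖ - ‖cauchyKernel ε (x - b)‖),
    sq_nonneg ‖cauchyKernel ε (x - a)‖, sq_nonneg ‖cauchyKernel ε (x - b)‖]

lemma integrable_inv_sq_add_sq_add {ε : ℝ} (hε : 0 < ε) (a b : ℝ) :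
    Integrable fun x : ℝ => ((x - a) ^ 2 + ε ^ 2)⁻¹ + ((x - b) ^ 2 + ε ^ 2)⁻¹ :=
  ((integrable_inv_sq_add_sq hε).comp_sub_right a).add
    ((integrable_inv_sq_add_sq hε).comp_sub_right b)

lemma integrable_cauchyKernel_mul {ε : ℝ} (hε : 0 < ε) (a b : ℝ) :
    Integrable fun x : ℝ => cauchyKernel ε (x - a) * cauchyKernel ε (x - b) := by
  refine (integrable_inv_sq_add_sq_add hε a b).mono' ?_
    (.of_forall fun x => norm_cauchyKernel_mul_le hε x a b)
  have := continuous_cauchyKernel hε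
  exact Continuous.aestronglyMeasurable (by fun_prop)

lemma integral_norm_cauchyKernel_mul_le {ε : ℝ} (hε : 0 < ε) (a b : ℝ) :
    ∫ x : ℝ, ‖cauchyKernel ε (x - a) * cauchyKernel ε (x - b)‖ ≤
      2 * ∫ u : ℝ, (u ^ 2 + ε ^ 2)⁻¹ := by
  calc _ ≤ ∫ x : ℝ, (((x - a) ^ 2 + ε ^ 2)⁻¹ + ((x - b) ^ 2 + ε ^ 2)⁻¹) :=
        integral_mono (integrable_cauchyKernel_mul hε a b).norm
          (integrable_inv_sq_add_sq_add hε a b) fun x => norm_cauchyKernel_mul_le hε x a b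
    _ = _ := by
        rw [integral_add ((integrable_inv_sq_add_sq hε).comp_sub_right a)
          ((integrable_inv_sq_add_sq hε).comp_sub_right b),
          integral_sub_right_eq_self (fun u : ℝ => (u ^ 2 + ε ^ 2)⁻¹),
          integral_sub_right_eq_self (fun u : ℝ => (u ^ 2 + ε ^ 2)⁻¹)]
        ring

lemma hasDerivAt_cauchyKernel {ε : ℝ} (hε : 0 < ε) (a x : ℝ) :
    HasDerivAt (fun x => cauchyKernel ε (x - a)) (-(cauchyKernel ε (x - a)) ^ 2) x := by
  have h1 : HasDerivAt (fun x : ℝ => (((x - a : ℝ) : ℂ) - ε * Complex.I)) 1 x := by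
    simpa using (((hasDerivAt_id x).sub_const a).ofReal_comp).sub_const ((ε : ℂ) * Complex.I)
  have h2 := h1.inv (sub_mul_I_ne_zero hε (x - a))
  unfold cauchyKernel
  exact h2.congr_deriv (by rw [inv_pow, neg_div, one_div])

lemma tendsto_cauchyKernel {ε : ℝ} (a : ℝ) {l : Filter ℝ}
    (hl : Tendsto (fun x : ℝ => |x|) l atTop) :
    Tendsto (fun x => cauchyKernel ε (x - a)) l (nhds 0) := by
  unfold cauchyKernel
  refine tendsto_inv₀_cobounded.comp ?_
  rw [← tendsto_norm_atTop_iff_cobounded]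
  refine tendsto_atTop_mono (f := fun x : ℝ => |x| - |a|) (fun x => ?_)
    (tendsto_atTop_add_const_right _ _ hl)
  calc |x| - |a| ≤ |x - a| := abs_sub_abs_le_abs_sub x a
    _ = |((((x - a : ℝ) : ℂ) - ε * Complex.I)).re| := by simp
    _ ≤ _ := Complex.abs_re_le_norm _

lemma cauchyKernel_sub_cauchyKernel {ε : ℝ} (hε : 0 < ε) {a b : ℝ} (x : ℝ) :
    cauchyKernel ε (x - a) - cauchyKernel ε (x - b) =
      (a - b) * (cauchyKernel ε (x - a) * cauchyKernel ε (x - b)) := by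
  have ha := sub_mul_I_ne_zero hε (x - a)
  have hb := sub_mul_I_ne_zero hε (x - b)
  unfold cauchyKernel
  rw [inv_sub_inv ha hb, ← mul_inv, div_eq_mul_inv]
  push_cast
  ring

/-- The Cauchy kernels with poles in the same half plane are orthogonal. -/
lemma integral_cauchyKernel_mul {ε : ℝ} (hε : 0 < ε) (a b : ℝ) :
    ∫ x : ℝ, cauchyKernel ε (x - a) * cauchyKernel ε (x - b) = 0 := by
  rcases eq_or_ne a b with rfl | hab
  · have h := integral_of_hasDerivAt_of_tendsto (f := fun x => -cauchyKernel ε (x - a))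
      (f' := fun x => cauchyKernel ε (x - a) * cauchyKernel ε (x - a)) (m := 0) (n := 0)
      (fun x => by
        have := (hasDerivAt_cauchyKernel hε a x).neg
        rw [neg_neg, sq] at this
        exact this)
      (integrable_cauchyKernel_mul hε a a)
      (by simpa using (tendsto_cauchyKernel (ε := ε) a tendsto_abs_atBot_atTop).neg)
      (by simpa using (tendsto_cauchyKernel (ε := ε) a tendsto_abs_atTop_atTop).neg)
    simpa using h
  · have hab' : (a : ℂ) - b ≠ 0 := by
      rw [← Complex.ofReal_sub]; exact_mod_cast sub_ne_zero.2 hab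
    set q : ℝ → ℂ := fun x => 1 + (b - a) * cauchyKernel ε (x - b) with hq
    have hqeq : ∀ x, q x * cauchyKernel ε (x - a) = cauchyKernel ε (x - b) := fun x => by
      have := cauchyKernel_sub_cauchyKernel hε (a := a) (b := b) x
      linear_combination this
    have him : ∀ u, 0 < (cauchyKernel ε u).im := fun u => by
      rw [cauchyKernel_im]; positivity
    have hqs : ∀ x, q x ∈ Complex.slitPlane := fun x => by
      rw [Complex.mem_slitPlane_iff]
      by_contra! hcon
      have h1 := congrArg Complex.im (hqeq x)
      rw [Complex.mul_im, hcon.2, zero_mul, add_zero] at h1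
      nlinarith [him (x - a), him (x - b), hcon.1]
    have hlim : ∀ l : Filter ℝ, Tendsto (fun x : ℝ => |x|) l atTop →
        Tendsto (fun x => Complex.log (q x)) l (nhds 0) := fun l hl => by
      have h1 : Tendsto q l (nhds 1) := by
        simpa using ((tendsto_cauchyKernel (ε := ε) b hl).const_mul
          ((b : ℂ) - a)).const_add 1
      have := (continuousAt_clog Complex.one_mem_slitPlane).tendsto.comp h1
      rwa [Complex.log_one] at this
    have h := integral_of_hasDerivAt_of_tendsto (f := fun x => Complex.log (q x))
      (f' := fun x => (a - b) * (cauchyKernel ε (x - a) * cauchyKernel ε (x - b)))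
      (m := 0) (n := 0)
      (fun x => by
        have h1 : HasDerivAt q _ x :=
          ((hasDerivAt_cauchyKernel hε b x).const_mul ((b : ℂ) - a)).const_add 1
        refine (h1.clog_real (hqs x)).congr_deriv (Eq.symm ?_)
        rw [eq_div_iff (Complex.slitPlane_ne_zero (hqs x))]
        linear_combination (a - b : ℂ) * cauchyKernel ε (x - b) * hqeq x)
      ((integrable_cauchyKernel_mul hε a b).const_mul _)
      (hlim _ tendsto_abs_atBot_atTop) (hlim _ tendsto_abs_atTop_atTop)
    rw [integral_const_mul, sub_zero] at h
    exact (mul_eq_zero.1 h).resolve_left hab'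

/-- The regularised Cauchy integral `∫ f(y) / (x - y - iε) dy`. -/
noncomputable def cauchyTransform (f : ℝ → ℝ) (ε x : ℝ) : ℂ :=
  ∫ y, (f y : ℂ) * cauchyKernel ε (x - y)

lemma integrable_mul_cauchyKernel {f : ℝ → ℝ} (hf : Integrable f) {ε : ℝ} (hε : 0 < ε) (x : ℝ) :
    Integrable fun y => (f y : ℂ) * cauchyKernel ε (x - y) := by
  have hc := continuous_cauchyKernel hε
  exact hf.ofReal.mul_bdd (c := ε⁻¹) (Continuous.aestronglyMeasurable (by fun_prop))
    (.of_forall fun y => norm_cauchyKernel_le hε _)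

lemma cauchyTransform_re {f : ℝ → ℝ} (hf : Integrable f) {ε : ℝ} (hε : 0 < ε) (x : ℝ) :
    (cauchyTransform f ε x).re = ∫ y, f y * ((x - y) / ((x - y) ^ 2 + ε ^ 2)) := by
  have h := integral_re (integrable_mul_cauchyKernel hf hε x)
  simp only [RCLike.re_to_complex, Complex.re_ofReal_mul, cauchyKernel_re] at h
  exact h.symm

lemma cauchyTransform_im {f : ℝ → ℝ} (hf : Integrable f) {ε : ℝ} (hε : 0 < ε) (x : ℝ) :
    (cauchyTransform f ε x).im = ∫ y, f y * (ε / ((x - y) ^ 2 + ε ^ 2)) := by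
  have h := integral_im (integrable_mul_cauchyKernel hf hε x)
  simp only [RCLike.im_to_complex, Complex.im_ofReal_mul, cauchyKernel_im] at h
  exact h.symm

lemma continuous_cauchyTransform {f : ℝ → ℝ} (hf : Integrable f) {ε : ℝ} (hε : 0 < ε) :
    Continuous (cauchyTransform f ε) := by
  have hc := continuous_cauchyKernel hε
  refine continuous_of_dominated (bound := fun y => |f y| * ε⁻¹)
    (fun x => (integrable_mul_cauchyKernel hf hε x).aestronglyMeasurable)
    (fun x => .of_forall fun y => ?_) (hf.abs.mul_const _) (.of_forall fun y => by fun_prop)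
  rw [norm_mul, Complex.norm_real, Real.norm_eq_abs]
  exact mul_le_mul_of_nonneg_left (norm_cauchyKernel_le hε _) (abs_nonneg _)

lemma integrable_mul_mul_cauchyKernel_mul {f : ℝ → ℝ} (hf : Integrable f) {ε : ℝ} (hε : 0 < ε) :
    Integrable (fun p : ℝ × (ℝ × ℝ) => ((f p.2.1 : ℂ) * f p.2.2) *
      (cauchyKernel ε (p.1 - p.2.1) * cauchyKernel ε (p.1 - p.2.2)))
      (volume.prod (volume.prod volume)) := by
  have hc := continuous_cauchyKernel hε
  have hff : Integrable (fun q : ℝ × ℝ => (f q.1 : ℂ) * f q.2) (volume.prod volume) :=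
    (hf.ofReal (𝕜 := ℂ)).mul_prod (hf.ofReal (𝕜 := ℂ))
  have hm : AEStronglyMeasurable (fun p : ℝ × (ℝ × ℝ) => ((f p.2.1 : ℂ) * f p.2.2) *
      (cauchyKernel ε (p.1 - p.2.1) * cauchyKernel ε (p.1 - p.2.2)))
      (volume.prod (volume.prod volume)) :=
    hff.aestronglyMeasurable.comp_snd.mul (Continuous.aestronglyMeasurable (by fun_prop))
  refine (integrable_prod_iff' hm).2 ⟨.of_forall fun q =>
    (integrable_cauchyKernel_mul hε q.1 q.2).const_mul ((f q.1 : ℂ) * f q.2), ?_⟩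
  refine (hff.norm.mul_const (2 * ∫ u : ℝ, (u ^ 2 + ε ^ 2)⁻¹)).mono'
    hm.norm.prod_swap.integral_prod_right' (.of_forall fun q => ?_)
  rw [Real.norm_of_nonneg (integral_nonneg fun _ => norm_nonneg _)]
  simp_rw [norm_mul ((f q.1 : ℂ) * f q.2)]
  rw [integral_const_mul]
  exact mul_le_mul_of_nonneg_left (integral_norm_cauchyKernel_mul_le hε _ _) (norm_nonneg _)

lemma cauchyTransform_sq (f : ℝ → ℝ) (ε x : ℝ) :
    cauchyTransform f ε x ^ 2 = ∫ q : ℝ × ℝ, ((f q.1 : ℂ) * f q.2) *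
      (cauchyKernel ε (x - q.1) * cauchyKernel ε (x - q.2)) ∂(volume.prod volume) := by
  rw [sq, cauchyTransform, ← integral_prod_mul]
  congr 1 with q
  ring

lemma integrable_cauchyTransform_sq {f : ℝ → ℝ} (hf : Integrable f) {ε : ℝ} (hε : 0 < ε) :
    Integrable fun x => cauchyTransform f ε x ^ 2 := by
  simp_rw [cauchyTransform_sq]
  exact (integrable_mul_mul_cauchyKernel_mul hf hε).integral_prod_left

lemma integral_cauchyTransform_sq {f : ℝ → ℝ} (hf : Integrable f) {ε : ℝ} (hε : 0 < ε) :
    ∫ x, cauchyTransform f ε x ^ 2 = 0 := by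
  simp_rw [cauchyTransform_sq]
  rw [integral_integral_swap (integrable_mul_mul_cauchyKernel_mul hf hε)]
  simp_rw [integral_const_mul, integral_cauchyKernel_mul hε, mul_zero, integral_zero]

lemma integrable_poissonKernel {ε : ℝ} (hε : 0 < ε) :
    Integrable fun u : ℝ => ε / (u ^ 2 + ε ^ 2) :=
  (integrable_inv_sq_add_sq hε).const_mul ε

lemma abs_cauchyTransform_im_le {f : ℝ → ℝ} (hf : Integrable f) {M : ℝ} (hM : ∀ x, |f x| ≤ M)
    {ε : ℝ} (hε : 0 < ε) (x : ℝ) : |(cauchyTransform f ε x).im| ≤ M * Real.pi := by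
  rw [cauchyTransform_im hf hε, ← Real.norm_eq_abs]
  refine (norm_integral_le_of_norm_le (((integrable_poissonKernel hε).comp_sub_left x).const_mul M)
    (.of_forall fun y => ?_)).trans_eq ?_
  · rw [norm_mul, Real.norm_eq_abs, Real.norm_of_nonneg (by positivity)]
    exact mul_le_mul_of_nonneg_right (hM y) (by positivity)
  · rw [integral_const_mul, integral_sub_left_eq_self (fun u : ℝ => ε / (u ^ 2 + ε ^ 2)),
      integral_poissonKernel hε]

lemma integrable_cauchyTransform_im {f : ℝ → ℝ} (hf : Integrable f) {ε : ℝ} (hε : 0 < ε) :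
    Integrable (fun x => (cauchyTransform f ε x).im) ∧
      ∫ x, |(cauchyTransform f ε x).im| ≤ Real.pi * ∫ y, |f y| := by
  have h : Integrable (fun p : ℝ × ℝ => f p.2 * (ε / ((p.1 - p.2) ^ 2 + ε ^ 2)))
      (volume.prod volume) :=
    hf.convolution_integrand (ContinuousLinearMap.mul ℝ ℝ) (integrable_poissonKernel hε)
  simp_rw [cauchyTransform_im hf hε]
  refine ⟨h.integral_prod_left, ?_⟩
  calc _ ≤ ∫ x, ∫ y, |f y| * (ε / ((x - y) ^ 2 + ε ^ 2)) := by
        refine integral_mono h.integral_prod_left.abs ?_ fun x => ?_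
        · refine h.norm.integral_prod_left.congr (.of_forall fun x => ?_)
          refine integral_congr_ae (.of_forall fun y => ?_)
          simp only
          rw [norm_mul, Real.norm_eq_abs, Real.norm_of_nonneg (by positivity)]
        · refine (abs_integral_le_integral_abs).trans_eq ?_
          refine integral_congr_ae (.of_forall fun y => ?_)
          simp only
          rw [abs_mul, abs_of_nonneg (a := ε / _) (by positivity)]
    _ = ∫ y, ∫ x, |f y| * (ε / ((x - y) ^ 2 + ε ^ 2)) := by
        refine integral_integral_swap (h.norm.congr (.of_forall fun p => ?_))
        beta_reduce
        rw [norm_mul, Real.norm_eq_abs, Real.norm_of_nonneg (by positivity)]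
        rfl
    _ = _ := by
        have hy : ∀ y, ∫ x : ℝ, ε / ((x - y) ^ 2 + ε ^ 2) = Real.pi := fun y => by
          rw [integral_sub_right_eq_self (fun u : ℝ => ε / (u ^ 2 + ε ^ 2)),
            integral_poissonKernel hε]
        simp_rw [integral_const_mul, hy]
        rw [integral_mul_const, mul_comm]

/-- A uniform `L²` bound for the conjugate Poisson integral of a bounded integrable function. -/
lemma integral_cauchyTransform_re_sq_le {f : ℝ → ℝ} (hf : Integrable f) {M : ℝ}
    (hM : ∀ x, |f x| ≤ M) {ε : ℝ} (hε : 0 < ε) :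
    Integrable (fun x => (cauchyTransform f ε x).re ^ 2) ∧
      ∫ x, (cauchyTransform f ε x).re ^ 2 ≤ M * Real.pi * (Real.pi * ∫ y, |f y|) := by
  have hcont := continuous_cauchyTransform hf hε
  have hM0 : 0 ≤ M := (abs_nonneg _).trans (hM 0)
  obtain ⟨hi, hi'⟩ := integrable_cauchyTransform_im hf hε
  have hle : ∀ x, (cauchyTransform f ε x).im ^ 2 ≤
      M * Real.pi * |(cauchyTransform f ε x).im| := fun x => by
    rw [← sq_abs, sq]
    exact mul_le_mul_of_nonneg_right (abs_cauchyTransform_im_le hf hM hε x) (abs_nonneg _)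
  have him : Integrable fun x => (cauchyTransform f ε x).im ^ 2 := by
    refine (hi.abs.const_mul (M * Real.pi)).mono' ?_ (.of_forall fun x => ?_)
    · exact Continuous.aestronglyMeasurable (by fun_prop)
    · rw [Real.norm_of_nonneg (sq_nonneg _)]
      exact hle x
  have hsq := (integrable_cauchyTransform_sq hf hε).re
  have heq : ∀ x, (cauchyTransform f ε x).re ^ 2 =
      RCLike.re (cauchyTransform f ε x ^ 2) + (cauchyTransform f ε x).im ^ 2 := fun x => by
    rw [sq (cauchyTransform f ε x), RCLike.re_to_complex, Complex.mul_re]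
    ring
  simp_rw [heq]
  refine ⟨hsq.add him, ?_⟩
  rw [integral_add hsq him, integral_re (integrable_cauchyTransform_sq hf hε),
    integral_cauchyTransform_sq hf hε, map_zero, zero_add]
  calc _ ≤ ∫ x, M * Real.pi * |(cauchyTransform f ε x).im| :=
        integral_mono him (hi.abs.const_mul _) hle
    _ ≤ _ := by
        rw [integral_const_mul]
        exact mul_le_mul_of_nonneg_left hi' (by positivity)

/-- The difference between the conjugate Poisson kernel and the truncated Hilbert kernel. -/
noncomputable def kernelDefect (s : ℝ) : ℝ :=
  s / (s ^ 2 + 1) - {s : ℝ | 1 < |s|}.indicator (fun s => 1 / s) s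

lemma measurable_kernelDefect : Measurable kernelDefect := by
  unfold kernelDefect
  refine Measurable.sub (by fun_prop) (Measurable.indicator (by fun_prop) ?_)
  exact measurableSet_lt measurable_const (by fun_prop)

lemma abs_kernelDefect_le (s : ℝ) : |kernelDefect s| ≤ (1 + s ^ 2)⁻¹ := by
  unfold kernelDefect
  have hs : 0 < s ^ 2 + 1 := by positivity
  by_cases h : 1 < |s|
  · rw [Set.indicator_of_mem (by exact h)]
    have h0 : s ≠ 0 := by rintro rfl; norm_num at h
    have : s / (s ^ 2 + 1) - 1 / s = -(s⁻¹ * (1 + s ^ 2)⁻¹) := by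
      have : 0 < 1 + s ^ 2 := by positivity
      field_simp
      ring
    rw [this, abs_neg, abs_mul, abs_of_pos (a := (1 + s ^ 2)⁻¹) (by positivity), abs_inv]
    exact mul_le_of_le_one_left (by positivity) (inv_le_one_of_one_le₀ h.le)
  · rw [Set.indicator_of_notMem (by exact h), sub_zero, abs_div, abs_of_pos hs, div_eq_mul_inv,
      add_comm 1]
    exact mul_le_of_le_one_left (by positivity) (not_lt.1 h)

lemma kernelDefect_neg (s : ℝ) : kernelDefect (-s) = -kernelDefect s := by
  unfold kernelDefect
  by_cases h : 1 < |s| <;> (simp [h, neg_div, inv_neg]; try ring)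

lemma integrable_kernelDefect : Integrable kernelDefect :=
  integrable_inv_one_add_sq.mono' measurable_kernelDefect.aestronglyMeasurable
    (.of_forall abs_kernelDefect_le)

lemma integral_kernelDefect : ∫ s, kernelDefect s = 0 := by
  have h := integral_neg_eq_self kernelDefect volume
  simp_rw [kernelDefect_neg] at h
  rw [integral_neg] at h
  linarith

lemma mul_kernelDefect_mul {ε : ℝ} (hε : 0 < ε) (u : ℝ) :
    ε⁻¹ * kernelDefect (ε⁻¹ * u) =
      u / (u ^ 2 + ε ^ 2) - {u : ℝ | ε < |u|}.indicator (fun u => 1 / u) u := by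
  unfold kernelDefect
  have h1 : ε⁻¹ * (ε⁻¹ * u / ((ε⁻¹ * u) ^ 2 + 1)) = u / (u ^ 2 + ε ^ 2) := by
    have : 0 < u ^ 2 + ε ^ 2 := by positivity
    field_simp
  have h2 : ε⁻¹ * (1 / (ε⁻¹ * u)) = 1 / u := by
    field_simp
  have h3 : 1 < |ε⁻¹ * u| ↔ ε < |u| := by
    rw [abs_mul, abs_of_pos (inv_pos.2 hε), ← div_eq_inv_mul, one_lt_div hε]
  rw [mul_sub, h1]
  congr 1
  by_cases h : ε < |u|
  · rw [Set.indicator_of_mem (by exact h3.2 h), Set.indicator_of_mem (by exact h), h2]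
  · rw [Set.indicator_of_notMem (by exact fun h' => h (h3.1 h')),
      Set.indicator_of_notMem (by exact h), mul_zero]

lemma integral_mul_kernelDefect (f : ℝ → ℝ) {ε : ℝ} (hε : 0 < ε) (x : ℝ) :
    ∫ s, f (x - ε * s) * kernelDefect s =
      ∫ y, f y * (ε⁻¹ * kernelDefect (ε⁻¹ * (x - y))) := by
  have h1 := Measure.integral_comp_mul_left
    (fun u => f (x - u) * (ε⁻¹ * kernelDefect (ε⁻¹ * u))) ε
  have h2 := integral_sub_left_eq_self (fun u => f (x - u) * (ε⁻¹ * kernelDefect (ε⁻¹ * u)))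
    volume x
  simp only [sub_sub_cancel] at h2
  rw [h2]
  have h3 : ∀ s, f (x - ε * s) * (ε⁻¹ * kernelDefect (ε⁻¹ * (ε * s))) =
      ε⁻¹ * (f (x - ε * s) * kernelDefect s) := fun s => by
    rw [inv_mul_cancel_left₀ hε.ne']; ring
  simp_rw [h3] at h1
  rw [integral_const_mul, abs_of_pos (inv_pos.2 hε), smul_eq_mul] at h1
  exact mul_left_cancel₀ (inv_ne_zero hε.ne') h1

lemma cauchyTransform_re_sub {f : ℝ → ℝ} (hf : Integrable f) {ε : ℝ} (hε : 0 < ε) (x : ℝ) :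
    (cauchyTransform f ε x).re - ∫ y in {y : ℝ | ε < |x - y|}, f y / (x - y) =
      ∫ s, f (x - ε * s) * kernelDefect s := by
  have hset : MeasurableSet {y : ℝ | ε < |x - y|} :=
    measurableSet_lt measurable_const (by fun_prop)
  rw [integral_mul_kernelDefect f hε, cauchyTransform_re hf hε, ← integral_indicator hset,
    ← integral_sub]
  · refine integral_congr_ae (.of_forall fun y => ?_)
    simp only
    rw [mul_kernelDefect_mul hε, mul_sub]
    congr 1
    by_cases h : ε < |x - y|
    · rw [Set.indicator_of_mem (by exact h), Set.indicator_of_mem (by exact h), mul_one_div]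
    · rw [Set.indicator_of_notMem (by exact h), Set.indicator_of_notMem (by exact h), mul_zero]
  · have h := (integrable_mul_cauchyKernel hf hε x).re
    simpa only [RCLike.re_to_complex, Complex.re_ofReal_mul, cauchyKernel_re] using h
  · refine (hf.abs.mul_const ε⁻¹).mono' ?_ (.of_forall fun y => ?_)
    · exact (AEMeasurable.div hf.aestronglyMeasurable.aemeasurable
        (by fun_prop)).aestronglyMeasurable.indicator hset
    · by_cases h : ε < |x - y|
      · rw [Set.indicator_of_mem (by exact h), norm_div, div_eq_mul_inv, Real.norm_eq_abs,
          Real.norm_eq_abs]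
        exact mul_le_mul_of_nonneg_left (inv_anti₀ hε h.le) (abs_nonneg _)
      · rw [Set.indicator_of_notMem (by exact h), norm_zero]
        positivity

/-- Where the principal value exists, the conjugate Poisson integral converges to it. -/
lemma HilbertPVR.tendsto_cauchyTransform_re {f : ℝ → ℝ} {x A : ℝ} (h : HilbertPVR f x A)
    (hc : Continuous f) (hf : Integrable f) {M : ℝ} (hM : ∀ x, |f x| ≤ M) :
    Tendsto (fun ε => (cauchyTransform f ε x).re) (nhdsWithin 0 (Set.Ioi 0))
      (nhds (Real.pi * A)) := by
  have h1 : Tendsto (fun ε : ℝ => ∫ s, f (x - ε * s) * kernelDefect s)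
      (nhdsWithin 0 (Set.Ioi 0)) (nhds (∫ s, f x * kernelDefect s)) := by
    refine tendsto_integral_filter_of_dominated_convergence (fun s => M * |kernelDefect s|)
      (.of_forall fun ε => ?_) (.of_forall fun ε => .of_forall fun s => ?_)
      (integrable_kernelDefect.abs.const_mul M) (.of_forall fun s => ?_)
    · exact (Continuous.aestronglyMeasurable (by fun_prop)).mul
        measurable_kernelDefect.aestronglyMeasurable
    · rw [norm_mul]
      exact mul_le_mul_of_nonneg_right (hM _) (abs_nonneg _)
    · have : Tendsto (fun ε : ℝ => f (x - ε * s) * kernelDefect s) (nhds 0)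
          (nhds (f (x - 0 * s) * kernelDefect s)) := Continuous.tendsto (by fun_prop) 0
      rw [zero_mul, sub_zero] at this
      exact this.mono_left nhdsWithin_le_nhds
  rw [integral_const_mul, integral_kernelDefect, mul_zero] at h1
  have h2 := h1.add (h.const_mul Real.pi)
  rw [zero_add] at h2
  refine h2.congr' ?_
  filter_upwards [self_mem_nhdsWithin] with ε hε
  rw [← cauchyTransform_re_sub hf hε, ← mul_assoc, mul_one_div_cancel Real.pi_ne_zero]
  ring

lemma abs_le_min_add_sq_div (a : ℝ) {R : ℝ} (hR : 0 < R) : |a| ≤ min |a| R + a ^ 2 / R := by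
  rcases le_total |a| R with h | h
  · rw [min_eq_left h]
    have : 0 ≤ a ^ 2 / R := by positivity
    linarith
  · rw [min_eq_right h]
    have : |a| ≤ a ^ 2 / R := by
      rw [le_div_iff₀ hR, ← sq_abs, sq]
      exact mul_le_mul_of_nonneg_left h (abs_nonneg a)
    linarith

/-- Pointwise convergence together with an `L²` bound yields weak convergence against bounded
integrable weights. -/
lemma tendsto_integral_mul_of_sq_bounded {ι : Type*} {l : Filter ι} [l.IsCountablyGenerated]
    {F : ι → ℝ → ℝ} {F₀ w : ℝ → ℝ} {K L : ℝ}
    (hF : ∀ᶠ i in l, Continuous (F i) ∧ Integrable (fun x => F i x ^ 2) ∧ ∫ x, F i x ^ 2 ≤ K)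
    (hF₀ : Continuous F₀) (hF₀i : Integrable fun x => F₀ x ^ 2)
    (hlim : ∀ x, Tendsto (fun i => F i x) l (nhds (F₀ x)))
    (hw : Integrable w) (hwL : ∀ x, |w x| ≤ L) :
    Tendsto (fun i => ∫ x, w x * F i x) l (nhds (∫ x, w x * F₀ x)) := by
  have hL : 0 ≤ L := (abs_nonneg _).trans (hwL 0)
  set K' : ℝ := L * (2 * |K| + 2 * ∫ x, F₀ x ^ 2) with hK'
  have hI0 : 0 ≤ ∫ x, F₀ x ^ 2 := integral_nonneg fun _ => sq_nonneg _
  have hK'0 : 0 ≤ K' := by positivity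
  have hwi : ∀ G : ℝ → ℝ, Continuous G → Integrable (fun x => G x ^ 2) →
      Integrable fun x => w x * G x := fun G hG hGi => by
    refine (hw.abs.add (hGi.const_mul L)).mono'
      (hw.aestronglyMeasurable.mul hG.aestronglyMeasurable) (.of_forall fun x => ?_)
    have h1 := abs_le_min_add_sq_div (G x) one_pos
    have h2 := min_le_right |G x| 1
    rw [norm_mul, Real.norm_eq_abs, Real.norm_eq_abs]
    calc |w x| * |G x| ≤ |w x| * (1 + G x ^ 2) :=
          mul_le_mul_of_nonneg_left (by linarith) (abs_nonneg _)
      _ ≤ _ := by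
          have := mul_le_mul_of_nonneg_right (hwL x) (sq_nonneg (G x))
          simp only [Pi.add_apply]
          linarith
  have hmin : ∀ R : ℝ, 0 < R →
      Tendsto (fun i => ∫ x, |w x| * min |F i x - F₀ x| R) l (nhds 0) := fun R hR => by
    have h := tendsto_integral_filter_of_dominated_convergence (μ := volume) (l := l)
      (F := fun i x => |w x| * min |F i x - F₀ x| R) (f := fun _ => (0 : ℝ))
      (fun x => |w x| * R) (hF.mono fun i hi => ?_) (.of_forall fun i => .of_forall fun x => ?_)
      (hw.abs.mul_const R) (.of_forall fun x => ?_)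
    · simpa using h
    · have := hi.1
      exact hw.abs.aestronglyMeasurable.mul (Continuous.aestronglyMeasurable (by fun_prop))
    · rw [norm_mul, Real.norm_eq_abs, Real.norm_eq_abs, abs_abs,
        abs_of_nonneg (le_min (abs_nonneg _) hR.le)]
      exact mul_le_mul_of_nonneg_left (min_le_right _ _) (abs_nonneg _)
    · have h1 : Tendsto (fun i => |F i x - F₀ x|) l (nhds 0) := by
        simpa using ((hlim x).sub_const (F₀ x)).abs
      have h2 := ((h1.min (tendsto_const_nhds (x := R))).const_mul |w x|)
      rwa [min_eq_left hR.le, mul_zero] at h2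
  rw [tendsto_iff_norm_sub_tendsto_zero, Metric.tendsto_nhds]
  intro δ hδ
  have hR : 0 < 2 * (K' + 1) / δ := by positivity
  filter_upwards [hF, (hmin _ hR).eventually_lt_const (half_pos hδ)] with i ⟨hic, hii, hiK⟩ hi
  rw [Real.dist_eq, sub_zero, abs_norm, ← integral_sub (hwi _ hic hii) (hwi _ hF₀ hF₀i)]
  set R := 2 * (K' + 1) / δ with hRdef
  have hsq : Integrable fun x => (F i x - F₀ x) ^ 2 := by
    refine ((hii.const_mul 2).add (hF₀i.const_mul 2)).mono'
      (Continuous.aestronglyMeasurable (by fun_prop)) (.of_forall fun x => ?_)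
    rw [Real.norm_of_nonneg (sq_nonneg _)]
    simp only [Pi.add_apply]
    nlinarith [sq_nonneg (F i x + F₀ x)]
  have hsqle : L * ∫ x, (F i x - F₀ x) ^ 2 ≤ K' := by
    refine mul_le_mul_of_nonneg_left ?_ hL
    calc _ ≤ ∫ x, (2 * F i x ^ 2 + 2 * F₀ x ^ 2) :=
          integral_mono hsq ((hii.const_mul 2).add (hF₀i.const_mul 2)) fun x => by
            simp only
            nlinarith [sq_nonneg (F i x + F₀ x)]
      _ ≤ _ := by
          rw [integral_add (hii.const_mul 2) (hF₀i.const_mul 2), integral_const_mul,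
            integral_const_mul]
          linarith [le_abs_self K]
  have hmini : Integrable fun x => |w x| * min |F i x - F₀ x| R := by
    refine hw.abs.mul_bdd (c := R) (Continuous.aestronglyMeasurable (by fun_prop))
      (.of_forall fun x => ?_)
    rw [Real.norm_of_nonneg (le_min (abs_nonneg _) hR.le)]
    exact min_le_right _ _
  calc ‖∫ x, (w x * F i x - w x * F₀ x)‖
      ≤ ∫ x, (|w x| * min |F i x - F₀ x| R + L / R * (F i x - F₀ x) ^ 2) := by
        refine norm_integral_le_of_norm_le (hmini.add (hsq.const_mul _)) (.of_forall fun x => ?_)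
        rw [← mul_sub, norm_mul, Real.norm_eq_abs, Real.norm_eq_abs]
        calc _ ≤ |w x| * (min |F i x - F₀ x| R + (F i x - F₀ x) ^ 2 / R) :=
              mul_le_mul_of_nonneg_left (abs_le_min_add_sq_div _ hR) (abs_nonneg _)
          _ ≤ _ := by
              have := mul_le_mul_of_nonneg_right (hwL x)
                (div_nonneg (sq_nonneg (F i x - F₀ x)) hR.le)
              rw [mul_add, div_mul_eq_mul_div, ← mul_div_assoc] at *
              rw [← mul_div_assoc] at this
              linarith
    _ = (∫ x, |w x| * min |F i x - F₀ x| R) + (L * ∫ x, (F i x - F₀ x) ^ 2) / R := by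
        rw [integral_add hmini (hsq.const_mul _), integral_const_mul, div_mul_eq_mul_div]
    _ < δ / 2 + δ / 2 := by
        refine add_lt_add hi ?_
        rw [div_lt_iff₀ hR, hRdef]
        field_simp
        linarith
    _ = δ := add_halves δ

lemma integral_mul_cauchyTransform_re {f : ℝ → ℝ} (hf : Integrable f)
    (hxf : Integrable fun x => x * f x) {ε : ℝ} (hε : 0 < ε) :
    ∫ x, x * f x * (cauchyTransform f ε x).re =
      1 / 2 * ∫ p : ℝ × ℝ, f p.1 * f p.2 *
        ((p.1 - p.2) ^ 2 / ((p.1 - p.2) ^ 2 + ε ^ 2)) ∂(volume.prod volume) := by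
  have hk : ∀ u, |u / (u ^ 2 + ε ^ 2)| ≤ ε⁻¹ := fun u => by
    rw [← cauchyKernel_re]
    exact (Complex.abs_re_le_norm _).trans (norm_cauchyKernel_le hε u)
  have hne : ∀ u : ℝ, u ^ 2 + ε ^ 2 ≠ 0 := fun u => by positivity
  have h : Integrable (fun p : ℝ × ℝ => p.1 * f p.1 * f p.2 *
      ((p.1 - p.2) / ((p.1 - p.2) ^ 2 + ε ^ 2))) (volume.prod volume) :=
    (hxf.mul_prod hf).mul_bdd (c := ε⁻¹)
      (Continuous.aestronglyMeasurable (by fun_prop (disch := exact fun _ => hne _)))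
      (.of_forall fun p => hk _)
  have h1 : ∫ x, x * f x * (cauchyTransform f ε x).re = ∫ p : ℝ × ℝ, p.1 * f p.1 * f p.2 *
      ((p.1 - p.2) / ((p.1 - p.2) ^ 2 + ε ^ 2)) ∂(volume.prod volume) := by
    rw [integral_prod _ h]
    congr 1 with x
    rw [cauchyTransform_re hf hε, ← integral_const_mul]
    congr 1 with y
    ring
  have h2 := integral_prod_swap (μ := (volume : Measure ℝ)) (ν := (volume : Measure ℝ))
    (fun p : ℝ × ℝ => p.1 * f p.1 * f p.2 * ((p.1 - p.2) / ((p.1 - p.2) ^ 2 + ε ^ 2)))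
  have h3 := integral_add h h.swap
  rw [h1]
  simp only [Function.comp_def, Prod.fst_swap, Prod.snd_swap] at h2 h3
  rw [h2, ← two_mul] at h3
  have h4 : ∫ p : ℝ × ℝ, f p.1 * f p.2 * ((p.1 - p.2) ^ 2 / ((p.1 - p.2) ^ 2 + ε ^ 2))
      ∂(volume.prod volume) = 2 * ∫ p : ℝ × ℝ, p.1 * f p.1 * f p.2 *
        ((p.1 - p.2) / ((p.1 - p.2) ^ 2 + ε ^ 2)) ∂(volume.prod volume) := by
    rw [← h3]
    congr 1 with p
    rw [← neg_sub p.1 p.2, neg_sq]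
    ring
  rw [h4]
  ring

/-- `x f(x)` is orthogonal to the Hilbert transform of `f` whenever `∫ f = 0`. -/
lemma integral_mul_hilbert_eq_zero {f g : ℝ → ℝ} {M L : ℝ} (hc : Continuous f) (hf : Integrable f)
    (hM : ∀ x, |f x| ≤ M) (hxf : Integrable fun x => x * f x) (hL : ∀ x, |x * f x| ≤ L)
    (hg : Continuous g) (hg2 : Integrable fun x => g x ^ 2) (hH : ∀ x, HilbertPVR f x (g x))
    (h0 : ∫ x, f x = 0) : ∫ x, x * f x * g x = 0 := by
  have hpos : ∀ᶠ ε : ℝ in nhdsWithin 0 (Set.Ioi 0), 0 < ε := self_mem_nhdsWithin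
  have hlim := tendsto_integral_mul_of_sq_bounded (l := nhdsWithin (0 : ℝ) (Set.Ioi 0))
    (F := fun ε x => (cauchyTransform f ε x).re) (F₀ := fun x => Real.pi * g x)
    (w := fun x => x * f x) (L := L)
    (hpos.mono fun ε hε => ⟨Complex.continuous_re.comp (continuous_cauchyTransform hf hε),
      integral_cauchyTransform_re_sq_le hf hM hε⟩)
    (by fun_prop) (by simpa only [mul_pow] using hg2.const_mul (Real.pi ^ 2))
    (fun x => (hH x).tendsto_cauchyTransform_re hc hf hM) hxf hL
  have hff : Integrable (fun p : ℝ × ℝ => f p.1 * f p.2) (volume.prod volume) := hf.mul_prod hf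
  have hae : ∀ᵐ p : ℝ × ℝ ∂(volume.prod volume), p.1 - p.2 ≠ 0 := by
    refine (Measure.ae_prod_iff_ae_ae
      (measurableSet_eq_fun (by fun_prop) (by fun_prop)).compl).2 (.of_forall fun x => ?_)
    filter_upwards [compl_mem_ae_iff.2 (measure_singleton x)] with y hy
    exact sub_ne_zero.2 fun h => hy h.symm
  have hlim2 := tendsto_integral_filter_of_dominated_convergence
    (l := nhdsWithin (0 : ℝ) (Set.Ioi 0)) (μ := volume.prod volume)
    (F := fun ε (p : ℝ × ℝ) => f p.1 * f p.2 * ((p.1 - p.2) ^ 2 / ((p.1 - p.2) ^ 2 + ε ^ 2)))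
    (f := fun p => f p.1 * f p.2) (fun p => |f p.1 * f p.2|)
    (.of_forall fun ε => hff.aestronglyMeasurable.mul
      (Measurable.aestronglyMeasurable (by fun_prop)))
    (.of_forall fun ε => .of_forall fun p => by
      rw [norm_mul, Real.norm_eq_abs, Real.norm_of_nonneg (by positivity)]
      exact mul_le_of_le_one_right (abs_nonneg _)
        (div_le_one_of_le₀ (by linarith [sq_nonneg ε]) (by positivity)))
    hff.abs (by
      filter_upwards [hae] with p hp
      have hcont : ContinuousAt (fun ε : ℝ => f p.1 * f p.2 *
          ((p.1 - p.2) ^ 2 / ((p.1 - p.2) ^ 2 + ε ^ 2))) 0 :=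
        continuousAt_const.mul (continuousAt_const.div (by fun_prop) (by simpa using hp))
      have := hcont.tendsto.mono_left (nhdsWithin_le_nhds (s := Set.Ioi 0))
      simpa [div_self (pow_ne_zero 2 hp)] using this)
  rw [integral_prod_mul, h0, zero_mul] at hlim2
  have hlim3 := (hlim2.const_mul (1 / 2)).congr' (hpos.mono fun ε hε =>
    (integral_mul_cauchyTransform_re hf hxf hε).symm)
  have h := tendsto_nhds_unique hlim hlim3
  simp_rw [mul_left_comm _ Real.pi] at h
  rw [integral_const_mul, mul_zero] at h
  exact (mul_eq_zero.1 h).resolve_left Real.pi_ne_zero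

lemma integral_add_mul_mul_pow_deriv {Q : ℝ → ℝ} (hQ : ContDiff ℝ 1 Q) {C : ℝ} (hC : 0 < C)
    (hQb : ∀ x, |Q x| ≤ C / (1 + x ^ 2)) (hxQ' : Integrable fun x => x * deriv Q x) {n : ℕ}
    (hn : n ≠ 0) :
    Integrable (fun x => Q x ^ (n + 1)) ∧ Integrable (fun x => Q x ^ n * (x * deriv Q x)) ∧
      ((n : ℝ) + 1) * ∫ x, Q x ^ n * (x * deriv Q x) = -∫ x, Q x ^ (n + 1) := by
  have hcont := hQ.continuous
  have hQC : ∀ x, |Q x| ≤ C := fun x => (hQb x).trans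
    (div_le_self hC.le (by linarith [sq_nonneg x]))
  have hQi : Integrable Q := (integrable_inv_one_add_sq.const_mul C).mono'
    hcont.aestronglyMeasurable (.of_forall hQb)
  have hpow : ∀ k x, ‖Q x ^ k‖ ≤ C ^ k := fun k x => by
    rw [norm_pow]
    exact pow_le_pow_left₀ (norm_nonneg _) (hQC x) k
  have h1 : Integrable fun x => Q x ^ (n + 1) := by
    simp_rw [pow_succ]
    exact hQi.bdd_mul (hcont.pow n).aestronglyMeasurable (.of_forall (hpow n))
  have h2 : Integrable fun x => Q x ^ n * (x * deriv Q x) :=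
    hxQ'.bdd_mul (hcont.pow n).aestronglyMeasurable (.of_forall (hpow n))
  refine ⟨h1, h2, ?_⟩
  have hbound : ∀ x, ‖x * Q x ^ (n + 1)‖ ≤ C ^ (n + 1) * |x|⁻¹ := fun x => by
    rcases eq_or_ne x 0 with rfl | hx
    · simp
    have hx' : 0 < |x| := abs_pos.2 hx
    obtain ⟨k, rfl⟩ : ∃ k, n = k + 1 := Nat.exists_eq_succ_of_ne_zero hn
    have h3 : |x| * |Q x| ≤ C * |x|⁻¹ := by
      calc _ ≤ |x| * (C / |x| ^ 2) := by
            refine mul_le_mul_of_nonneg_left ((hQb x).trans ?_) hx'.le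
            rw [sq_abs]
            exact div_le_div_of_nonneg_left hC.le (by positivity) (by linarith)
        _ = _ := by field_simp
    calc ‖x * Q x ^ (k + 1 + 1)‖ = ‖Q x ^ (k + 1)‖ * (|x| * |Q x|) := by
          rw [norm_mul, pow_succ _ (k + 1), norm_mul, Real.norm_eq_abs, Real.norm_eq_abs (Q x)]
          ring
      _ ≤ C ^ (k + 1) * (C * |x|⁻¹) :=
          mul_le_mul (hpow _ x) h3 (by positivity) (by positivity)
      _ = _ := by ring
  have hlim : ∀ l : Filter ℝ, Tendsto (fun x : ℝ => |x|) l atTop →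
      Tendsto (fun x => x * Q x ^ (n + 1)) l (nhds 0) := fun l hl =>
    squeeze_zero_norm hbound (by
      simpa using (tendsto_inv_atTop_zero.comp hl).const_mul (C ^ (n + 1)))
  have h := integral_of_hasDerivAt_of_tendsto (f := fun x => x * Q x ^ (n + 1))
    (f' := fun x => Q x ^ (n + 1) + ((n : ℝ) + 1) * (Q x ^ n * (x * deriv Q x)))
    (fun x => by
      have hd := ((hQ.differentiable one_ne_zero x).hasDerivAt).pow (n + 1)
      refine ((hasDerivAt_id x).mul hd).congr_deriv ?_
      simp
      ring)
    (h1.add (h2.const_mul _)) (hlim _ tendsto_abs_atBot_atTop) (hlim _ tendsto_abs_atTop_atTop)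
  rw [integral_add h1 (h2.const_mul _), integral_const_mul] at h
  linarith

/-- Pohozaev identity I for gBO ground states:
`(2/(m(m+1))) ∫ Q^{m+1} = ∫ Q²`. -/
theorem gBO_pohozaev_I (m : ℕ) (hm : 2 ≤ m) (Q : ℝ → ℝ)
    (hQ : ContDiff ℝ 1 Q) (C : ℝ) (hC : 0 < C)
    (hQbound : ∀ x : ℝ, |Q x| ≤ C / (1 + x ^ 2))
    (hQ'bound : ∀ x : ℝ, |deriv Q x| ≤ C / (1 + |x|) ^ 3)
    (HQ' : ℝ → ℝ)
    (hHQ' : ∀ x : ℝ, HilbertPVR (deriv Q) x (HQ' x))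
    (hHQ'cont : Continuous HQ')
    (hHQ'bound : ∀ x : ℝ, |HQ' x| ≤ C / (1 + x ^ 2))
    (heq : ∀ x : ℝ, -Q x - HQ' x + (Q x) ^ m / (m : ℝ) = 0) :
    (2 / ((m : ℝ) * ((m : ℝ) + 1))) * ∫ x : ℝ, (Q x) ^ (m + 1) =
      ∫ x : ℝ, (Q x) ^ 2 := by
  have hQc := hQ.continuous
  have hc : Continuous (deriv Q) := hQ.continuous_deriv le_rfl
  have hgi : Integrable fun x : ℝ => C / (1 + x ^ 2) := integrable_inv_one_add_sq.const_mul C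
  have hgC : ∀ x : ℝ, C / (1 + x ^ 2) ≤ C := fun x =>
    div_le_self hC.le (by linarith [sq_nonneg x])
  have hQ'le : ∀ x, (1 + |x|) * |deriv Q x| ≤ C / (1 + x ^ 2) := fun x => by
    have hx := abs_nonneg x
    calc _ ≤ (1 + |x|) * (C / (1 + |x|) ^ 3) :=
          mul_le_mul_of_nonneg_left (hQ'bound x) (by positivity)
      _ = C / (1 + |x|) ^ 2 := by field_simp
      _ ≤ _ := div_le_div_of_nonneg_left hC.le (by positivity) (by nlinarith [sq_abs x])
  have hfb : ∀ x, |deriv Q x| ≤ C / (1 + x ^ 2) := fun x => by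
    nlinarith [hQ'le x, mul_nonneg (abs_nonneg x) (abs_nonneg (deriv Q x))]
  have hxfb : ∀ x, |x * deriv Q x| ≤ C / (1 + x ^ 2) := fun x => by
    rw [abs_mul]
    nlinarith [hQ'le x, abs_nonneg (deriv Q x)]
  have hf : Integrable (deriv Q) := hgi.mono' hc.aestronglyMeasurable (.of_forall hfb)
  have hxf : Integrable fun x => x * deriv Q x :=
    hgi.mono' (Continuous.aestronglyMeasurable (by fun_prop)) (.of_forall hxfb)
  have hHi : Integrable HQ' := hgi.mono' hHQ'cont.aestronglyMeasurable (.of_forall hHQ'bound)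
  have hH2 : Integrable fun x => HQ' x ^ 2 := by
    simp_rw [sq]
    exact hHi.bdd_mul hHQ'cont.aestronglyMeasurable
      (.of_forall fun x => (hHQ'bound x).trans (hgC x))
  have hlim : ∀ l : Filter ℝ, Tendsto (fun x : ℝ => |x|) l atTop → Tendsto Q l (nhds 0) :=
    fun l hl => squeeze_zero_norm hQbound (by
      have h2 : Tendsto (fun x : ℝ => x ^ 2) l atTop := by
        simpa [Function.comp_def] using (tendsto_pow_atTop two_ne_zero).comp hl
      exact (tendsto_atTop_add_const_left l 1 h2).const_div_atTop C)
  have h0 : ∫ x, deriv Q x = 0 := by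
    have h := integral_of_hasDerivAt_of_tendsto
      (fun x => (hQ.differentiable one_ne_zero x).hasDerivAt) hf
      (hlim _ tendsto_abs_atBot_atTop) (hlim _ tendsto_abs_atTop_atTop)
    rw [h, sub_zero]
  have horth := integral_mul_hilbert_eq_zero hc hf (fun x => (hfb x).trans (hgC x)) hxf
    (fun x => (hxfb x).trans (hgC x)) hHQ'cont hH2 hHQ' h0
  obtain ⟨-, hi1, he1⟩ := integral_add_mul_mul_pow_deriv hQ hC hQbound hxf one_ne_zero
  obtain ⟨-, him, hem⟩ := integral_add_mul_mul_pow_deriv hQ hC hQbound hxf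
    (n := m) (by omega)
  have hsplit : ∀ x, x * deriv Q x * HQ' x =
      (m : ℝ)⁻¹ * (Q x ^ m * (x * deriv Q x)) - Q x ^ 1 * (x * deriv Q x) := fun x => by
    rw [show HQ' x = Q x ^ m / m - Q x by linarith [heq x]]
    ring
  simp_rw [hsplit] at horth
  rw [integral_sub (him.const_mul _) hi1, integral_const_mul] at horth
  have hm0 : (m : ℝ) ≠ 0 := by positivity
  have hm1 : (m : ℝ) + 1 ≠ 0 := by positivity
  have h5 : ∫ x, Q x ^ (m + 1) = -(((m : ℝ) + 1) * ∫ x, Q x ^ m * (x * deriv Q x)) := by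
    linarith
  have h6 : ∫ x, Q x ^ 2 = -(2 * ∫ x, Q x ^ 1 * (x * deriv Q x)) := by
    norm_num at he1 ⊢
    linarith
  rw [h5, h6, ← sub_eq_zero.1 horth]
  field_simp
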